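/- arXiv:2510.00417 — 8 statements merged into one kernel-verified Lean document; each statement's English description precedes it below -/
import Mathlib

section
/- Let V be a real normed vector space, let N ≥ 1 be an integer, let v_1, …, v_N ∈ V, and set v̄ := (1/N)·Σ_{i=1}^N v_i. Suppose γ ≥ 0 satisfies (1/N)·Σ_{i=1}^N ‖v_i − v̄‖² ≤ γ. Then for every nonempty subset S ⊆ {1,…,N}, the sample average v_S := (1/|S|)·Σ_{i∈S} v_i satisfies ‖v_S − v̄‖² ≤ (N·(N−|S|)/|S|²)·γ. -/
theorem norm_sum_sq_le_card_mul_sum_norm_sq {ι V : Type*} [SeminormedAddCommGroup V]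
    (s : Finset ι) (f : ι → V) :
    ‖∑ i ∈ s, f i‖ ^ 2 ≤ (s.card : ℝ) * ∑ i ∈ s, ‖f i‖ ^ 2 :=
  (pow_le_pow_left₀ (norm_nonneg _) (norm_sum_le s f) 2).trans sq_sum_le_card_mul_sum_sq

/-- **Sample-average deviation bound** (abstract form of the paper's Lemma on sampled
constraint functions).  If `v₁, …, v_N` are vectors in a real normed space with mean `v̄`
and `(1/N)·Σ ‖vᵢ − v̄‖² ≤ γ`, then for every nonempty `S ⊆ [N]` the sample average
`v_S := (1/|S|)·Σ_{i∈S} vᵢ` satisfies `‖v_S − v̄‖² ≤ (N(N−|S|)/|S|²)·γ`. -/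
theorem sample_average_deviation_bound
    {V : Type*} [NormedAddCommGroup V] [NormedSpace ℝ V]
    (N : ℕ) (hN : 1 ≤ N) (v : Fin N → V) (vbar : V)
    (hvbar : vbar = (N : ℝ)⁻¹ • ∑ i, v i)
    (γ : ℝ) (hγ : 0 ≤ γ)
    (hvar : (N : ℝ)⁻¹ * ∑ i, ‖v i - vbar‖ ^ 2 ≤ γ)
    (S : Finset (Fin N)) (hS : S.Nonempty) :
    ‖(S.card : ℝ)⁻¹ • (∑ i ∈ S, v i) - vbar‖ ^ 2 ≤
      (N : ℝ) * ((N : ℝ) - (S.card : ℝ)) / (S.card : ℝ) ^ 2 * γ := by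
  have hNpos : (0 : ℝ) < N := by exact_mod_cast hN
  have hSpos : (0 : ℝ) < S.card := by exact_mod_cast hS.card_pos
  have hsum : ∑ i, (v i - vbar) = 0 := by
    rw [Finset.sum_sub_distrib, Finset.sum_const, Finset.card_univ, Fintype.card_fin,
      ← Nat.cast_smul_eq_nsmul ℝ, hvbar, smul_inv_smul₀ hNpos.ne', sub_self]
  have hcompl : ∑ i ∈ S, (v i - vbar) = -∑ i ∈ Sᶜ, (v i - vbar) :=
    eq_neg_of_add_eq_zero_left ((Finset.sum_add_sum_compl S _).trans hsum)
  have hdev : (S.card : ℝ)⁻¹ • (∑ i ∈ S, v i) - vbar =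
      (S.card : ℝ)⁻¹ • ∑ i ∈ S, (v i - vbar) := by
    rw [Finset.sum_sub_distrib, Finset.sum_const, ← Nat.cast_smul_eq_nsmul ℝ, smul_sub,
      inv_smul_smul₀ hSpos.ne']
  have hcard : ((Sᶜ.card : ℕ) : ℝ) = N - S.card := by
    rw [Finset.card_compl, Fintype.card_fin, Nat.cast_sub (card_finset_fin_le S)]
  have hvar' : ∑ i ∈ Sᶜ, ‖v i - vbar‖ ^ 2 ≤ N * γ :=
    (Finset.sum_le_univ_sum_of_nonneg fun i => sq_nonneg _).trans
      ((inv_mul_le_iff₀ hNpos).mp hvar)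
  calc ‖(S.card : ℝ)⁻¹ • (∑ i ∈ S, v i) - vbar‖ ^ 2
      = ((S.card : ℝ) ^ 2)⁻¹ * ‖∑ i ∈ Sᶜ, (v i - vbar)‖ ^ 2 := by
        rw [hdev, hcompl, norm_smul, norm_neg, mul_pow, norm_inv, Real.norm_natCast, inv_pow]
    _ ≤ ((S.card : ℝ) ^ 2)⁻¹ * ((Sᶜ.card : ℝ) * (N * γ)) := by
        gcongr
        exact (norm_sum_sq_le_card_mul_sum_norm_sq _ _).trans (by gcongr)
    _ = (N : ℝ) * ((N : ℝ) - (S.card : ℝ)) / (S.card : ℝ) ^ 2 * γ := by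
        rw [hcard]
        ring
end

section
/- Let n ≥ m ≥ 1, let A and B be real n×m matrices, suppose A has full column rank (AᵀA is invertible), and set A† := (AᵀA)⁻¹Aᵀ. If the spectral norm of A†(B − A) is strictly less than 1, then the matrix A·A†·B has rank m (its kernel as a linear map ℝᵐ → ℝⁿ is trivial); in particular B also has full column rank, and A and B are acute perturbations of each other. -/
open Matrix

/-- Spectral (ℓ²-operator) norm of a real rectangular matrix. -/
noncomputable def spec {n m : ℕ} (A : Matrix (Fin n) (Fin m) ℝ) : ℝ :=
  ‖LinearMap.toContinuousLinearMap (Matrix.toEuclideanLin A)‖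

theorem eq_zero_of_add_toEuclideanLin_eq_zero {m : ℕ} {E : Matrix (Fin m) (Fin m) ℝ}
    (hE : spec E < 1) {x : EuclideanSpace ℝ (Fin m)}
    (hx : x + Matrix.toEuclideanLin E x = 0) : x = 0 := by
  by_contra hne
  have hpos : 0 < ‖x‖ := norm_pos_iff.mpr hne
  have hle : ‖Matrix.toEuclideanLin E x‖ ≤ spec E * ‖x‖ :=
    (LinearMap.toContinuousLinearMap (Matrix.toEuclideanLin E)).le_opNorm x
  have hnorm : ‖x‖ = ‖Matrix.toEuclideanLin E x‖ := by
    rw [eq_neg_of_add_eq_zero_left hx, norm_neg, ← eq_neg_of_add_eq_zero_left hx]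
  nlinarith

theorem rank_eq_of_ker_toEuclideanLin_eq_bot {n m : ℕ} {M : Matrix (Fin n) (Fin m) ℝ}
    (hM : LinearMap.ker (Matrix.toEuclideanLin M) = ⊥) : M.rank = m := by
  rw [Matrix.rank_eq_finrank_range_toLin M (EuclideanSpace.basisFun (Fin n) ℝ).toBasis
    (EuclideanSpace.basisFun (Fin m) ℝ).toBasis, ← Matrix.toEuclideanLin_eq_toLin_orthonormal,
    LinearMap.finrank_range_of_inj (LinearMap.ker_eq_bot.mp hM), finrank_euclideanSpace_fin]

/-- **Acute perturbation criterion** (paper's Lemma on acute perturbations).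
If `A` has full column rank (`AᵀA` invertible), `A† = (AᵀA)⁻¹Aᵀ`, and
`‖A†(B − A)‖ < 1` in spectral norm, then `A·A†·B` has rank `m` (trivial kernel as a
linear map `ℝᵐ → ℝⁿ`), and in particular `B` has full column rank; hence `A` and `B`
are acute perturbations of each other. -/
theorem acute_perturbation_of_small_relative_error
    {n m : ℕ} (hm : 1 ≤ m) (hmn : m ≤ n)
    (A B : Matrix (Fin n) (Fin m) ℝ)
    (hA : IsUnit (Aᵀ * A))
    (h : spec ((Aᵀ * A)⁻¹ * Aᵀ * (B - A)) < 1) :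
    (A * ((Aᵀ * A)⁻¹ * Aᵀ) * B).rank = m ∧
      LinearMap.ker (Matrix.toEuclideanLin (A * ((Aᵀ * A)⁻¹ * Aᵀ) * B)) = ⊥ ∧
      B.rank = m := by
  have hleft : (Aᵀ * A)⁻¹ * Aᵀ * A = 1 := by
    rw [Matrix.mul_assoc, Matrix.nonsing_inv_mul _ ((Matrix.isUnit_iff_isUnit_det _).mp hA)]
  set P := (Aᵀ * A)⁻¹ * Aᵀ
  have hsplit : P * (A * P * B) = 1 + P * (B - A) := by
    rw [Matrix.mul_sub, hleft, add_sub_cancel, ← Matrix.mul_assoc, ← Matrix.mul_assoc, hleft,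
      Matrix.one_mul]
  have hker : LinearMap.ker (Matrix.toEuclideanLin (A * P * B)) = ⊥ := by
    refine LinearMap.ker_eq_bot'.mpr fun x hx => eq_zero_of_add_toEuclideanLin_eq_zero h ?_
    have hcomp : Matrix.toEuclideanLin (P * (A * P * B)) x = 0 := by
      rw [Matrix.toLpLin_mul_same, LinearMap.comp_apply, hx, map_zero]
    rwa [hsplit, map_add, LinearMap.add_apply, Matrix.toLpLin_one, LinearMap.id_apply] at hcomp
  have hrank := rank_eq_of_ker_toEuclideanLin_eq_bot hker
  refine ⟨hrank, hker, le_antisymm (Matrix.rank_le_width B) ?_⟩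
  exact hrank.symm.trans_le (Matrix.rank_mul_le_right _ _)
end

section
/- Let n ≥ m ≥ 1 and let A and B be real n×m matrices. Suppose σ > 0 satisfies ‖Av‖ ≥ σ‖v‖ for all v ∈ ℝᵐ, let g ∈ ℝⁿ with ‖g‖ ≤ κ, and suppose ‖A†‖·‖B − A‖ ≤ 1/3, where A† := (AᵀA)⁻¹Aᵀ and norms are spectral. Then B has full column rank and, with B† := (BᵀB)⁻¹Bᵀ, one has ‖A†g − B†g‖ ≤ (9κ/(2σ²))·‖B − A‖. -/
open Matrix

open scoped Matrix.Norms.L2Operator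

section LeastSquares

variable {n m l : ℕ}

theorem spec_eq_norm (M : Matrix (Fin n) (Fin m) ℝ) : spec M = ‖M‖ := rfl

theorem norm_toEuclideanLin_le (M : Matrix (Fin n) (Fin m) ℝ) (v : EuclideanSpace ℝ (Fin m)) :
    ‖Matrix.toEuclideanLin M v‖ ≤ ‖M‖ * ‖v‖ :=
  (LinearMap.toContinuousLinearMap (Matrix.toEuclideanLin M)).le_opNorm v

theorem toEuclideanLin_mul_apply (M : Matrix (Fin n) (Fin m) ℝ) (N : Matrix (Fin m) (Fin l) ℝ)
    (v : EuclideanSpace ℝ (Fin l)) :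
    Matrix.toEuclideanLin (M * N) v = Matrix.toEuclideanLin M (Matrix.toEuclideanLin N v) := by
  simp [Matrix.toLpLin_apply]

theorem norm_transpose_eq (M : Matrix (Fin n) (Fin m) ℝ) : ‖Mᵀ‖ = ‖M‖ := by
  rw [← conjTranspose_eq_transpose_of_trivial, l2_opNorm_conjTranspose]

theorem norm_transpose_mul_self (M : Matrix (Fin n) (Fin m) ℝ) : ‖Mᵀ * M‖ = ‖M‖ * ‖M‖ := by
  rw [← conjTranspose_eq_transpose_of_trivial, l2_opNorm_conjTranspose_mul_self]

theorem norm_le_one_of_transpose_mul_self {P : Matrix (Fin n) (Fin n) ℝ} (hP : Pᵀ * P = P) :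
    ‖P‖ ≤ 1 := by
  have h := norm_transpose_mul_self P
  rw [hP] at h
  nlinarith [norm_nonneg P]

variable {M : Matrix (Fin n) (Fin m) ℝ} {τ : ℝ}

theorem isUnit_transpose_mul_self_of_bound (hτ : 0 < τ)
    (hM : ∀ v : EuclideanSpace ℝ (Fin m), τ * ‖v‖ ≤ ‖Matrix.toEuclideanLin M v‖) :
    IsUnit (Mᵀ * M) := by
  rw [← Matrix.mulVec_injective_iff_isUnit]
  change Function.Injective (Mᵀ * M).mulVecLin
  rw [← LinearMap.ker_eq_bot, Matrix.ker_mulVecLin_transpose_mul_self, LinearMap.ker_eq_bot']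
  intro v hv
  have h := hM (WithLp.toLp 2 v)
  have h0 : Matrix.toEuclideanLin M (WithLp.toLp 2 v) = 0 := by
    rw [Matrix.toLpLin_toLp, Matrix.toLin'_apply', hv, WithLp.toLp_zero]
  rw [h0, norm_zero] at h
  have hn : ‖WithLp.toLp 2 v‖ = 0 :=
    le_antisymm (nonpos_of_mul_nonpos_right h hτ) (norm_nonneg _)
  simpa using hn

theorem transpose_mul_self_inv_mul (h : IsUnit (Mᵀ * M)) : (Mᵀ * M)⁻¹ * Mᵀ * M = 1 := by
  rw [Matrix.mul_assoc, Matrix.nonsing_inv_mul _ ((Matrix.isUnit_iff_isUnit_det _).1 h)]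

theorem transpose_mul_proj (h : IsUnit (Mᵀ * M)) : Mᵀ * (M * ((Mᵀ * M)⁻¹ * Mᵀ)) = Mᵀ := by
  rw [← Matrix.mul_assoc, ← Matrix.mul_assoc,
    Matrix.mul_nonsing_inv _ ((Matrix.isUnit_iff_isUnit_det _).1 h), Matrix.one_mul]

theorem transpose_proj :
    (M * ((Mᵀ * M)⁻¹ * Mᵀ))ᵀ = M * ((Mᵀ * M)⁻¹ * Mᵀ) := by
  simp [Matrix.transpose_mul, Matrix.transpose_nonsing_inv, Matrix.mul_assoc]

theorem proj_transpose_mul_self (h : IsUnit (Mᵀ * M)) :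
    (M * ((Mᵀ * M)⁻¹ * Mᵀ))ᵀ * (M * ((Mᵀ * M)⁻¹ * Mᵀ)) = M * ((Mᵀ * M)⁻¹ * Mᵀ) := by
  rw [transpose_proj]
  conv_lhs => rw [Matrix.mul_assoc, Matrix.mul_assoc, transpose_mul_proj h]

theorem norm_one_sub_proj_le (h : IsUnit (Mᵀ * M)) : ‖1 - M * ((Mᵀ * M)⁻¹ * Mᵀ)‖ ≤ 1 := by
  apply norm_le_one_of_transpose_mul_self
  have h2 := proj_transpose_mul_self h
  rw [transpose_proj] at h2
  rw [Matrix.transpose_sub, transpose_proj, Matrix.transpose_one, Matrix.mul_sub, Matrix.sub_mul,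
    Matrix.sub_mul, h2]
  simp

theorem norm_pinv_le (hτ : 0 < τ)
    (hM : ∀ v : EuclideanSpace ℝ (Fin m), τ * ‖v‖ ≤ ‖Matrix.toEuclideanLin M v‖) :
    ‖(Mᵀ * M)⁻¹ * Mᵀ‖ ≤ 1 / τ := by
  refine ContinuousLinearMap.opNorm_le_bound _ (by positivity) fun v => ?_
  have hP := norm_le_one_of_transpose_mul_self
    (proj_transpose_mul_self (isUnit_transpose_mul_self_of_bound hτ hM))
  have h := hM (Matrix.toEuclideanLin ((Mᵀ * M)⁻¹ * Mᵀ) v)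
  rw [← toEuclideanLin_mul_apply] at h
  have h' := h.trans ((norm_toEuclideanLin_le _ v).trans
    (mul_le_mul_of_nonneg_right hP (norm_nonneg v)))
  rw [one_mul] at h'
  rw [one_div_mul_eq_div, le_div_iff₀' hτ]
  exact h'

theorem norm_inv_transpose_mul_self_le (hτ : 0 < τ)
    (hM : ∀ v : EuclideanSpace ℝ (Fin m), τ * ‖v‖ ≤ ‖Matrix.toEuclideanLin M v‖) :
    ‖(Mᵀ * M)⁻¹‖ ≤ 1 / τ * (1 / τ) := by
  have h := isUnit_transpose_mul_self_of_bound hτ hM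
  have e : (Mᵀ * M)⁻¹ = ((Mᵀ * M)⁻¹ * Mᵀ) * ((Mᵀ * M)⁻¹ * Mᵀ)ᵀ := by
    rw [Matrix.transpose_mul, Matrix.transpose_transpose, ← Matrix.mul_assoc,
      transpose_mul_self_inv_mul h, Matrix.one_mul, Matrix.transpose_nonsing_inv,
      Matrix.transpose_mul, Matrix.transpose_transpose]
  have hp := norm_pinv_le hτ hM
  rw [e]
  refine (l2_opNorm_mul _ _).trans ?_
  rw [norm_transpose_eq]
  gcongr

theorem pinv_sub_pinv {A B : Matrix (Fin n) (Fin m) ℝ} (hA : IsUnit (Aᵀ * A))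
    (hB : IsUnit (Bᵀ * B)) :
    (Aᵀ * A)⁻¹ * Aᵀ - (Bᵀ * B)⁻¹ * Bᵀ =
      (Bᵀ * B)⁻¹ * Bᵀ * (B - A) * ((Aᵀ * A)⁻¹ * Aᵀ) -
        (Bᵀ * B)⁻¹ * (B - A)ᵀ * (1 - A * ((Aᵀ * A)⁻¹ * Aᵀ)) := by
  have h1 := transpose_mul_self_inv_mul hB
  have h2 : Aᵀ * (1 - A * ((Aᵀ * A)⁻¹ * Aᵀ)) = 0 := by
    rw [Matrix.mul_sub, transpose_mul_proj hA, Matrix.mul_one, sub_self]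
  rw [Matrix.mul_sub _ B A, h1, Matrix.transpose_sub, Matrix.mul_assoc _ (Bᵀ - Aᵀ),
    Matrix.sub_mul Bᵀ Aᵀ, h2, sub_zero, Matrix.sub_mul, Matrix.one_mul, Matrix.mul_sub Bᵀ,
    Matrix.mul_sub, Matrix.mul_one]
  simp only [Matrix.mul_assoc]
  abel

theorem bound_of_pinv_mul_norm_sub_le {A B : Matrix (Fin n) (Fin m) ℝ} {σ : ℝ} (hσ : 0 < σ)
    (hA : ∀ v : EuclideanSpace ℝ (Fin m), σ * ‖v‖ ≤ ‖Matrix.toEuclideanLin A v‖)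
    (h13 : ‖(Aᵀ * A)⁻¹ * Aᵀ‖ * ‖B - A‖ ≤ 1 / 3) (v : EuclideanSpace ℝ (Fin m)) :
    2 * σ / 3 * ‖v‖ ≤ ‖Matrix.toEuclideanLin B v‖ := by
  have hU := isUnit_transpose_mul_self_of_bound hσ hA
  have hp := norm_pinv_le hσ hA
  set X := (Aᵀ * A)⁻¹ * Aᵀ with hX
  have e : v = Matrix.toEuclideanLin X (Matrix.toEuclideanLin B v) -
      Matrix.toEuclideanLin (X * (B - A)) v := by
    rw [← toEuclideanLin_mul_apply, ← LinearMap.sub_apply, ← map_sub, Matrix.mul_sub,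
      sub_sub_cancel, hX, transpose_mul_self_inv_mul hU]
    simp
  have h1 : ‖Matrix.toEuclideanLin X (Matrix.toEuclideanLin B v)‖ ≤
      1 / σ * ‖Matrix.toEuclideanLin B v‖ :=
    (norm_toEuclideanLin_le _ _).trans (by gcongr)
  have h2 : ‖Matrix.toEuclideanLin (X * (B - A)) v‖ ≤ 1 / 3 * ‖v‖ :=
    (norm_toEuclideanLin_le _ _).trans (by gcongr; exact (l2_opNorm_mul _ _).trans h13)
  have h3 : ‖v‖ ≤ 1 / σ * ‖Matrix.toEuclideanLin B v‖ + 1 / 3 * ‖v‖ := by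
    conv_lhs => rw [e]
    exact (norm_sub_le _ _).trans (add_le_add h1 h2)
  have h4 : 2 / 3 * ‖v‖ ≤ ‖Matrix.toEuclideanLin B v‖ / σ := by
    rw [← one_div_mul_eq_div σ]; linarith
  rw [le_div_iff₀ hσ] at h4
  linarith

theorem norm_pinv_sub_pinv_le {A B : Matrix (Fin n) (Fin m) ℝ} {σ : ℝ} (hσ : 0 < σ) (hτ : 0 < τ)
    (hA : ∀ v : EuclideanSpace ℝ (Fin m), σ * ‖v‖ ≤ ‖Matrix.toEuclideanLin A v‖)
    (hB : ∀ v : EuclideanSpace ℝ (Fin m), τ * ‖v‖ ≤ ‖Matrix.toEuclideanLin B v‖) :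
    ‖(Aᵀ * A)⁻¹ * Aᵀ - (Bᵀ * B)⁻¹ * Bᵀ‖ ≤
      (1 / τ * (1 / σ) + 1 / τ * (1 / τ)) * ‖B - A‖ := by
  have hUA := isUnit_transpose_mul_self_of_bound hσ hA
  have hpA := norm_pinv_le hσ hA
  have hpB := norm_pinv_le hτ hB
  have hiB := norm_inv_transpose_mul_self_le hτ hB
  have hQ := norm_one_sub_proj_le hUA
  rw [pinv_sub_pinv hUA (isUnit_transpose_mul_self_of_bound hτ hB)]
  have h1 : ‖(Bᵀ * B)⁻¹ * Bᵀ * (B - A) * ((Aᵀ * A)⁻¹ * Aᵀ)‖ ≤ 1 / τ * ‖B - A‖ * (1 / σ) :=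
    (l2_opNorm_mul _ _).trans (mul_le_mul ((l2_opNorm_mul _ _).trans (by gcongr)) hpA
      (norm_nonneg _) (by positivity))
  have h2 : ‖(Bᵀ * B)⁻¹ * (B - A)ᵀ * (1 - A * ((Aᵀ * A)⁻¹ * Aᵀ))‖ ≤
      1 / τ * (1 / τ) * ‖B - A‖ * 1 := by
    refine (l2_opNorm_mul _ _).trans (mul_le_mul ((l2_opNorm_mul _ _).trans ?_) hQ
      (norm_nonneg _) (by positivity))
    rw [norm_transpose_eq]
    gcongr
  linarith [norm_sub_le ((Bᵀ * B)⁻¹ * Bᵀ * (B - A) * ((Aᵀ * A)⁻¹ * Aᵀ))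
    ((Bᵀ * B)⁻¹ * (B - A)ᵀ * (1 - A * ((Aᵀ * A)⁻¹ * Aᵀ)))]

end LeastSquares

/-- **Difference of least-squares multipliers** (matrix core of the paper's Lemma).
If `A` has smallest singular value at least `σ > 0`, `‖g‖ ≤ κ`, and
`‖A†‖·‖B − A‖ ≤ 1/3` where `A† = (AᵀA)⁻¹Aᵀ`, then `B` has full column rank and, with
`B† = (BᵀB)⁻¹Bᵀ`, one has `‖A†g − B†g‖ ≤ (9κ/(2σ²))·‖B − A‖`. -/
theorem multiplier_difference_bound
    {n m : ℕ} (hm : 1 ≤ m) (hmn : m ≤ n)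
    (A B : Matrix (Fin n) (Fin m) ℝ) (σ κ : ℝ) (hσ : 0 < σ)
    (hA : ∀ v : EuclideanSpace ℝ (Fin m), σ * ‖v‖ ≤ ‖Matrix.toEuclideanLin A v‖)
    (g : EuclideanSpace ℝ (Fin n)) (hg : ‖g‖ ≤ κ)
    (h13 : spec ((Aᵀ * A)⁻¹ * Aᵀ) * spec (B - A) ≤ 1 / 3) :
    B.rank = m ∧
      ‖Matrix.toEuclideanLin ((Aᵀ * A)⁻¹ * Aᵀ) g -
          Matrix.toEuclideanLin ((Bᵀ * B)⁻¹ * Bᵀ) g‖ ≤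
        9 * κ / (2 * σ ^ 2) * spec (B - A) := by
  rw [spec_eq_norm, spec_eq_norm] at h13
  rw [spec_eq_norm]
  have hB := bound_of_pinv_mul_norm_sub_le hσ hA h13
  have hτ : 0 < 2 * σ / 3 := by positivity
  refine ⟨?_, ?_⟩
  · rw [← Matrix.rank_transpose_mul_self,
      Matrix.rank_of_isUnit _ (isUnit_transpose_mul_self_of_bound hτ hB), Fintype.card_fin]
  · have hκ : 0 ≤ κ := (norm_nonneg g).trans hg
    rw [← LinearMap.sub_apply, ← map_sub]
    calc
      _ ≤ ‖(Aᵀ * A)⁻¹ * Aᵀ - (Bᵀ * B)⁻¹ * Bᵀ‖ * ‖g‖ := norm_toEuclideanLin_le _ g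
      _ ≤ (1 / (2 * σ / 3) * (1 / σ) + 1 / (2 * σ / 3) * (1 / (2 * σ / 3))) * ‖B - A‖ * κ := by
        gcongr
        exact norm_pinv_sub_pinv_le hσ hτ hA hB
      _ = 15 / 4 * (κ / σ ^ 2 * ‖B - A‖) := by field_simp; ring
      _ ≤ 9 / 2 * (κ / σ ^ 2 * ‖B - A‖) :=
        mul_le_mul_of_nonneg_right (by norm_num) (by positivity)
      _ = 9 * κ / (2 * σ ^ 2) * ‖B - A‖ := by field_simp
end

section
/- Let H be a real symmetric n×n matrix, β ≥ 0, 0 ≤ δ ≤ 1/3, and let d = d̄ + r with d̄, r ∈ ℝⁿ orthogonal (⟨d̄, r⟩ = 0), ‖r‖ ≤ δ‖d‖, and |d̄ᵀH d̄| ≥ β‖d̄‖². Then |dᵀH d| ≥ ((1 − δ/3)·β − 3‖H‖·δ)·‖d‖², where ‖H‖ is the spectral norm. -/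
open Matrix
open scoped RealInnerProductSpace

/-- **Quadratic-form lower bound with small residual component** (paper's inequality
showing sampled problems inherit the strongly Morse property).  If `H` is symmetric,
`0 ≤ δ ≤ 1/3`, `d = d̄ + r` with `⟨d̄, r⟩ = 0`, `‖r‖ ≤ δ‖d‖`, and `|d̄ᵀHd̄| ≥ β‖d̄‖²`,
then `|dᵀHd| ≥ ((1 − δ/3)β − 3‖H‖δ)‖d‖²`. -/
theorem quadratic_form_small_residual_lower_bound
    {n : ℕ} (H : Matrix (Fin n) (Fin n) ℝ) (hH : H.IsSymm)
    (β δ : ℝ) (hβ : 0 ≤ β) (hδ0 : 0 ≤ δ) (hδ : δ ≤ 1 / 3)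
    (d dbar r : EuclideanSpace ℝ (Fin n))
    (hdecomp : d = dbar + r) (horth : ⟪dbar, r⟫ = 0)
    (hr : ‖r‖ ≤ δ * ‖d‖)
    (hquad : β * ‖dbar‖ ^ 2 ≤ |⟪dbar, Matrix.toEuclideanLin H dbar⟫|) :
    ((1 - δ / 3) * β - 3 * spec H * δ) * ‖d‖ ^ 2 ≤
      |⟪d, Matrix.toEuclideanLin H d⟫| := by
  set T := LinearMap.toContinuousLinearMap (Matrix.toEuclideanLin H) with hT
  have hTa : ∀ x, Matrix.toEuclideanLin H x = T x := fun _ => rfl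
  have hspec : spec H = ‖T‖ := rfl
  rw [hspec, hTa]
  rw [hTa] at hquad
  have bound : ∀ x y, |⟪x, T y⟫| ≤ ‖T‖ * (‖x‖ * ‖y‖) := fun x y =>
    calc |⟪x, T y⟫| ≤ ‖x‖ * ‖T y‖ := abs_real_inner_le_norm x (T y)
      _ ≤ ‖x‖ * (‖T‖ * ‖y‖) := by gcongr; exact T.le_opNorm y
      _ = ‖T‖ * (‖x‖ * ‖y‖) := by ring
  have pyth : ‖d‖ ^ 2 = ‖dbar‖ ^ 2 + ‖r‖ ^ 2 := by
    rw [hdecomp, norm_add_sq_real, horth]; ring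
  have hdbar : ‖dbar‖ ≤ ‖d‖ :=
    (sq_le_sq₀ (norm_nonneg _) (norm_nonneg _)).1 (by nlinarith [sq_nonneg ‖r‖])
  have hcross : |⟪dbar, T r⟫| ≤ ‖T‖ * δ * ‖d‖ ^ 2 :=
    calc |⟪dbar, T r⟫| ≤ ‖T‖ * (‖dbar‖ * ‖r‖) := bound _ _
      _ ≤ ‖T‖ * (‖d‖ * (δ * ‖d‖)) := by gcongr
      _ = ‖T‖ * δ * ‖d‖ ^ 2 := by ring
  have hres : |⟪r, T d⟫| ≤ ‖T‖ * δ * ‖d‖ ^ 2 :=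
    calc |⟪r, T d⟫| ≤ ‖T‖ * (‖r‖ * ‖d‖) := bound _ _
      _ ≤ ‖T‖ * ((δ * ‖d‖) * ‖d‖) := by gcongr
      _ = ‖T‖ * δ * ‖d‖ ^ 2 := by ring
  have expand : ⟪dbar, T dbar⟫ = ⟪d, T d⟫ - ⟪dbar, T r⟫ - ⟪r, T d⟫ := by
    simp only [hdecomp, map_add, inner_add_left, inner_add_right]; ring
  have htri : |⟪dbar, T dbar⟫| ≤ |⟪d, T d⟫| + |⟪dbar, T r⟫| + |⟪r, T d⟫| := by
    rw [expand]
    exact (abs_sub _ _).trans (by gcongr; exact abs_sub _ _)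
  have hrsq : ‖r‖ ^ 2 ≤ δ / 3 * ‖d‖ ^ 2 :=
    calc ‖r‖ ^ 2 ≤ (δ * ‖d‖) ^ 2 := by gcongr
      _ = δ * δ * ‖d‖ ^ 2 := by ring
      _ ≤ δ * (1 / 3) * ‖d‖ ^ 2 := by gcongr
      _ = δ / 3 * ‖d‖ ^ 2 := by ring
  have hmain : β * ((1 - δ / 3) * ‖d‖ ^ 2) ≤ β * ‖dbar‖ ^ 2 :=
    mul_le_mul_of_nonneg_left (by linarith) hβ
  have hnonneg : 0 ≤ ‖T‖ * δ * ‖d‖ ^ 2 := by positivity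
  linarith
end

section
/- Let m ≥ 1 be an integer and κ, σ, β > 0 be real numbers. Define η₁ := (2√m/σ + m)·κ, η₂ := 2mκ, η₃ := (β/2)·σ² / (η₁σ² + (β/2)·η₂), η₄ := η₁·η₃ + (1 + mκ)·κ, and ε̄ := (β/2)·σ² / (η₁σ² + (β/2)·η₂ + η₂·η₄). Then for every ε with 0 < ε < ε̄, one has η₂·ε < 2σ², β/2 − η₁·ε > 0, and 0 < (β/2 + η₄)/(2σ² − η₂·ε) < (β/2 − η₁·ε)/(η₂·ε). -/
/-- **Ordering of the penalty-parameter thresholds** (part (a) of the paper's lemma on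
Fletcher's augmented Lagrangian).  With `η₁ := (2√m/σ + m)κ`, `η₂ := 2mκ`,
`η₃ := (β/2)σ²/(η₁σ² + (β/2)η₂)`, `η₄ := η₁η₃ + (1 + mκ)κ`, and
`ε̄ := (β/2)σ²/(η₁σ² + (β/2)η₂ + η₂η₄)`, for every `ε ∈ (0, ε̄)` one has
`η₂ε < 2σ²`, `β/2 − η₁ε > 0`, and `0 < (β/2 + η₄)/(2σ² − η₂ε) < (β/2 − η₁ε)/(η₂ε)`. -/
theorem penalty_threshold_ordering
    (m : ℕ) (hm : 1 ≤ m) (κ σ β : ℝ) (hκ : 0 < κ) (hσ : 0 < σ) (hβ : 0 < β)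
    (η₁ η₂ η₃ η₄ εbar : ℝ)
    (hη₁ : η₁ = (2 * Real.sqrt m / σ + m) * κ)
    (hη₂ : η₂ = 2 * m * κ)
    (hη₃ : η₃ = β / 2 * σ ^ 2 / (η₁ * σ ^ 2 + β / 2 * η₂))
    (hη₄ : η₄ = η₁ * η₃ + (1 + m * κ) * κ)
    (hεbar : εbar = β / 2 * σ ^ 2 / (η₁ * σ ^ 2 + β / 2 * η₂ + η₂ * η₄))
    (ε : ℝ) (hε : 0 < ε) (hεlt : ε < εbar) :
    η₂ * ε < 2 * σ ^ 2 ∧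
      0 < β / 2 - η₁ * ε ∧
      0 < (β / 2 + η₄) / (2 * σ ^ 2 - η₂ * ε) ∧
      (β / 2 + η₄) / (2 * σ ^ 2 - η₂ * ε) < (β / 2 - η₁ * ε) / (η₂ * ε) := by
  have hm0 : (0 : ℝ) < m := by exact_mod_cast hm
  have hs : 0 < σ ^ 2 := by positivity
  have h1 : 0 < η₁ := by rw [hη₁]; positivity
  have h2 : 0 < η₂ := by rw [hη₂]; positivity
  have h3 : 0 < η₃ := by rw [hη₃]; positivity
  have h4 : 0 < η₄ := by rw [hη₄]; positivity
  rw [hεbar, lt_div_iff₀ (by positivity)] at hεlt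
  clear hη₁ hη₂ hη₃ hη₄ hεbar
  have h1s : 0 < η₁ * ε * σ ^ 2 := by positivity
  have h2b : 0 < β / 2 * (η₂ * ε) := by positivity
  have h24 : 0 < η₂ * ε * η₄ := by positivity
  have h12 : 0 < η₁ * η₂ * ε ^ 2 := by positivity
  have hη₁ε : η₁ * ε < β / 2 := lt_of_mul_lt_mul_right (by linarith) hs.le
  have hη₂ε : η₂ * ε < σ ^ 2 :=
    lt_of_mul_lt_mul_left (by linarith : β / 2 * (η₂ * ε) < β / 2 * σ ^ 2) (by positivity)
  have hden : 0 < 2 * σ ^ 2 - η₂ * ε := by linarith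
  refine ⟨by linarith, by linarith, by positivity, ?_⟩
  rw [div_lt_div_iff₀ hden (by positivity)]
  linarith
end

section
/- Let F : ℝⁿ → ℝ be twice continuously differentiable and suppose its Hessian map is M-Lipschitz: ‖∇²F(x) − ∇²F(y)‖ ≤ M‖x − y‖ (spectral norm) for all x, y ∈ ℝⁿ. Fix x ∈ ℝⁿ, t > 0, and β > 0 such that: (i) vᵀ∇²F(x)v ≥ (β/3)‖v‖² for all v ∈ ℝⁿ; (ii) t·‖∇²F(x)‖ ≤ 1; and (iii) M·t·‖∇F(x)‖ ≤ β/3. Then the gradient-descent step x⁺ := x − t·∇F(x) satisfies ‖∇F(x⁺)‖ ≤ (1 − βt/6)·‖∇F(x)‖. -/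
open scoped RealInnerProductSpace

/-- A `C²` function on a Hilbert space has a differentiable gradient. -/
lemma ContDiff.differentiable_gradient {E : Type*} [NormedAddCommGroup E]
    [InnerProductSpace ℝ E] [CompleteSpace E] {f : E → ℝ} (hf : ContDiff ℝ 2 f) :
    Differentiable ℝ (gradient f) := by
  have hd : Differentiable ℝ (fderiv ℝ f) :=
    (hf.fderiv_right (m := 1) (by norm_num)).differentiable one_ne_zero
  exact (InnerProductSpace.toDual ℝ E).symm.toContinuousLinearEquiv.differentiable.comp hd

lemma inner_fderiv_gradient_apply {E : Type*} [NormedAddCommGroup E]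
    [InnerProductSpace ℝ E] [CompleteSpace E] {f : E → ℝ} {x : E}
    (hf : DifferentiableAt ℝ (gradient f) x) (u v : E) :
    ⟪fderiv ℝ (gradient f) x u, v⟫ = fderiv ℝ (fderiv ℝ f) x u v := by
  have h : HasFDerivAt (fderiv ℝ f) _ x :=
    toDual_comp_gradient (𝕜 := ℝ) (f := f) ▸
      (InnerProductSpace.toDual ℝ E).toContinuousLinearEquiv.hasFDerivAt.comp x hf.hasFDerivAt
  rw [h.fderiv]
  rfl

/-- The Hessian of a `C²` function, as an endomorphism, is symmetric. -/
lemma ContDiff.isSymmetric_fderiv_gradient {E : Type*} [NormedAddCommGroup E]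
    [InnerProductSpace ℝ E] [CompleteSpace E] {f : E → ℝ} (hf : ContDiff ℝ 2 f) (x : E) :
    (fderiv ℝ (gradient f) x).IsSymmetric := by
  intro u v
  have hd := hf.differentiable_gradient x
  have hs : IsSymmSndFDerivAt ℝ f x := hf.contDiffAt.isSymmSndFDerivAt (by simp)
  change ⟪fderiv ℝ (gradient f) x u, v⟫ = ⟪u, fderiv ℝ (gradient f) x v⟫
  rw [real_inner_comm _ u, inner_fderiv_gradient_apply hd, inner_fderiv_gradient_apply hd]
  exact hs u v

/-- First-order Taylor estimate for a map whose derivative is Lipschitz. -/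
lemma norm_sub_sub_fderiv_le_of_lipschitz {E G : Type*} [NormedAddCommGroup E] [NormedSpace ℝ E]
    [NormedAddCommGroup G] [NormedSpace ℝ G] {g : E → G} (hg : Differentiable ℝ g) {M : ℝ}
    (hM : ∀ x y, ‖fderiv ℝ g x - fderiv ℝ g y‖ ≤ M * ‖x - y‖) (x d : E) :
    ‖g (x + d) - g x - fderiv ℝ g x d‖ ≤ M / 2 * ‖d‖ ^ 2 := by
  have hφ (s : ℝ) : HasDerivAt (fun s : ℝ => g (x + s • d) - g x - s • fderiv ℝ g x d)
      (fderiv ℝ g (x + s • d) d - fderiv ℝ g x d) s := by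
    have hline : HasDerivAt (fun s : ℝ => x + s • d) d s := by
      simpa using ((hasDerivAt_id s).smul_const d).const_add x
    have hlin : HasDerivAt (fun s : ℝ => s • fderiv ℝ g x d) (fderiv ℝ g x d) s := by
      simpa using (hasDerivAt_id s).smul_const (fderiv ℝ g x d)
    exact (((hg _).hasFDerivAt.comp_hasDerivAt s hline).sub_const (g x)).sub hlin
  have hB (s : ℝ) : HasDerivAt (fun s : ℝ => M / 2 * ‖d‖ ^ 2 * s ^ 2) (M * ‖d‖ ^ 2 * s) s := by
    refine ((hasDerivAt_pow 2 s).const_mul (M / 2 * ‖d‖ ^ 2)).congr_deriv ?_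
    norm_num
    ring
  have key := image_norm_le_of_norm_deriv_right_le_deriv_boundary (a := 0) (b := 1)
    (fun s _ => (hφ s).continuousAt.continuousWithinAt)
    (fun s _ => (hφ s).hasDerivWithinAt) (by simp) hB
    (fun s hs => by
      calc ‖fderiv ℝ g (x + s • d) d - fderiv ℝ g x d‖
          ≤ ‖fderiv ℝ g (x + s • d) - fderiv ℝ g x‖ * ‖d‖ :=
            (fderiv ℝ g (x + s • d) - fderiv ℝ g x).le_opNorm d
        _ ≤ M * ‖x + s • d - x‖ * ‖d‖ := by gcongr; exact hM _ _
        _ = M * ‖d‖ ^ 2 * s := by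
            rw [add_sub_cancel_left, norm_smul, Real.norm_of_nonneg hs.1]; ring)
    (Set.right_mem_Icc.2 zero_le_one)
  simpa using key

/-- If `T` is symmetric with `⟪v, T v⟫ ≥ c ‖v‖²` and `t ‖T‖ ≤ 1`, then `1 - t T` contracts
by the factor `1 - t c`. -/
lemma LinearMap.IsSymmetric.norm_sub_smul_apply_le {E : Type*} [NormedAddCommGroup E]
    [InnerProductSpace ℝ E] {T : E →L[ℝ] E} (hT : T.IsSymmetric) {c t : ℝ} (ht : 0 ≤ t)
    (hc : ∀ v, c * ‖v‖ ^ 2 ≤ ⟪v, T v⟫) (htT : t * ‖T‖ ≤ 1) (v : E) :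
    ‖v - t • T v‖ ≤ (1 - t * c) * ‖v‖ := by
  have hle (w : E) : ⟪w, T w⟫ ≤ ‖T‖ * ‖w‖ ^ 2 := by
    calc ⟪w, T w⟫ ≤ ‖w‖ * ‖T w‖ := real_inner_le_norm _ _
      _ ≤ ‖w‖ * (‖T‖ * ‖w‖) := by gcongr; exact T.le_opNorm w
      _ = ‖T‖ * ‖w‖ ^ 2 := by ring
  rcases eq_or_ne v 0 with rfl | hv
  · simp
  have htc : 0 ≤ 1 - t * c := by
    have hcT : c ≤ ‖T‖ := le_of_mul_le_mul_right ((hc v).trans (hle v)) (by positivity)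
    nlinarith
  let A : E →L[ℝ] E := ContinuousLinearMap.id ℝ E - t • T
  have hA : A.IsSymmetric := by
    intro u w
    have h : ⟪T u, w⟫ = ⟪u, T w⟫ := hT u w
    simp [A, inner_sub_left, inner_sub_right, inner_smul_left, inner_smul_right, h]
  have hnorm : ‖A‖ ≤ 1 - t * c := by
    rw [A.norm_eq_iSup_rayleighQuotient hA]
    refine ciSup_le fun w => ?_
    have hre : A.reApplyInnerSelf w = ‖w‖ ^ 2 - t * ⟪w, T w⟫ := by
      simp [A, ContinuousLinearMap.reApplyInnerSelf_apply, inner_sub_left, inner_smul_left,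
        real_inner_comm]
    have h1 := mul_le_mul_of_nonneg_left (hc w) ht
    have h2 := mul_le_mul_of_nonneg_left (hle w) ht
    have h3 := mul_le_mul_of_nonneg_right htT (sq_nonneg ‖w‖)
    have hnn : 0 ≤ A.reApplyInnerSelf w := by rw [hre]; linarith
    rw [abs_of_nonneg (div_nonneg hnn (sq_nonneg _))]
    refine div_le_of_le_mul₀ (sq_nonneg _) htc ?_
    rw [hre]
    linarith
  exact A.le_of_opNorm_le hnorm v

/-- **One-step gradient contraction** (drives the linear convergence of the warm-started
subproblem solves; in the paper `F` is Fletcher's augmented Lagrangian).  If `F` is twice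
continuously differentiable with `M`-Lipschitz Hessian, `vᵀ∇²F(x)v ≥ (β/3)‖v‖²` for all
`v`, `t‖∇²F(x)‖ ≤ 1`, and `Mt‖∇F(x)‖ ≤ β/3`, then the gradient-descent step
`x⁺ = x − t∇F(x)` satisfies `‖∇F(x⁺)‖ ≤ (1 − βt/6)‖∇F(x)‖`. -/
theorem gradient_descent_one_step_contraction
    {n : ℕ} (F : EuclideanSpace ℝ (Fin n) → ℝ) (hF : ContDiff ℝ 2 F)
    (M : ℝ)
    (hM : ∀ x y : EuclideanSpace ℝ (Fin n),
      ‖fderiv ℝ (gradient F) x - fderiv ℝ (gradient F) y‖ ≤ M * ‖x - y‖)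
    (x : EuclideanSpace ℝ (Fin n)) (t β : ℝ) (ht : 0 < t) (hβ : 0 < β)
    (h1 : ∀ v : EuclideanSpace ℝ (Fin n),
      β / 3 * ‖v‖ ^ 2 ≤ ⟪v, fderiv ℝ (gradient F) x v⟫)
    (h2 : t * ‖fderiv ℝ (gradient F) x‖ ≤ 1)
    (h3 : M * t * ‖gradient F x‖ ≤ β / 3) :
    ‖gradient F (x - t • gradient F x)‖ ≤ (1 - β * t / 6) * ‖gradient F x‖ := by
  set g := gradient F x with hg
  set H := fderiv ℝ (gradient F) x with hH
  have htaylor := norm_sub_sub_fderiv_le_of_lipschitz hF.differentiable_gradient hM x (-(t • g))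
  have hlin := (hF.isSymmetric_fderiv_gradient x).norm_sub_smul_apply_le ht.le h1 h2 g
  rw [← sub_eq_add_neg, ← hg, ← hH, norm_neg, norm_smul, Real.norm_of_nonneg ht.le, map_neg,
    map_smul, sub_neg_eq_add] at htaylor
  have hquad : M / 2 * (t * ‖g‖) ^ 2 ≤ β * t / 6 * ‖g‖ := by
    have := mul_le_mul_of_nonneg_right h3 (by positivity : 0 ≤ t / 2 * ‖g‖)
    linarith
  calc ‖gradient F (x - t • g)‖
      = ‖(gradient F (x - t • g) - g + t • H g) + (g - t • H g)‖ := by congr 1; abel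
    _ ≤ ‖gradient F (x - t • g) - g + t • H g‖ + ‖g - t • H g‖ := norm_add_le _ _
    _ ≤ β * t / 6 * ‖g‖ + (1 - t * (β / 3)) * ‖g‖ := add_le_add (htaylor.trans hquad) hlin
    _ = (1 - β * t / 6) * ‖g‖ := by ring
end

section
/- Let F : ℝⁿ → ℝ be twice continuously differentiable with M-Lipschitz Hessian map: ‖∇²F(x) − ∇²F(y)‖ ≤ M‖x − y‖ for all x, y. Let t > 0, β > 0 with q := βt/6 ∈ (0, 1), and let the sequence (x_i) be defined by x_{i+1} = x_i − t·∇F(x_i). Suppose: (i) vᵀ∇²F(x₀)v ≥ (β/2)‖v‖² for all v ∈ ℝⁿ; (ii) ‖∇F(x_i)‖ ≤ (1 − q)^i·‖∇F(x₀)‖ for all i ≥ 0; and (iii) M·‖∇F(x₀)‖ ≤ β²/36. Then for every i ≥ 0 and every v ∈ ℝⁿ, vᵀ∇²F(x_i)v ≥ (β/3)‖v‖². -/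
open scoped RealInnerProductSpace

/-- If the increments of a sequence decay geometrically with ratio `1 - q`, its displacement
is controlled by the geometric sum. -/
theorem mul_norm_sub_le_of_geometric_increments {E : Type*} [SeminormedAddCommGroup E]
    {x : ℕ → E} {c q : ℝ} (hq : 0 ≤ q)
    (h : ∀ i, ‖x (i + 1) - x i‖ ≤ c * (1 - q) ^ i) (i : ℕ) :
    q * ‖x i - x 0‖ ≤ c * (1 - (1 - q) ^ i) := by
  induction i with
  | zero => simp
  | succ i ih =>
    calc q * ‖x (i + 1) - x 0‖ ≤ q * (‖x (i + 1) - x i‖ + ‖x i - x 0‖) := by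
          gcongr
          exact norm_sub_le_norm_sub_add_norm_sub _ _ _
      _ ≤ q * (c * (1 - q) ^ i) + c * (1 - (1 - q) ^ i) := by
          rw [mul_add]
          gcongr
          exact h i
      _ = c * (1 - (1 - q) ^ (i + 1)) := by ring

/-- A lower bound on the quadratic form of an operator is stable under perturbations that are
small in operator norm. -/
theorem mul_norm_sq_le_inner_of_norm_sub_le {E : Type*} [SeminormedAddCommGroup E]
    [InnerProductSpace ℝ E] {A B : E →L[ℝ] E} {a δ : ℝ} {v : E}
    (hA : a * ‖v‖ ^ 2 ≤ ⟪v, A v⟫) (hAB : ‖B - A‖ ≤ δ) :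
    (a - δ) * ‖v‖ ^ 2 ≤ ⟪v, B v⟫ := by
  have h : |⟪v, (B - A) v⟫| ≤ δ * ‖v‖ ^ 2 :=
    calc |⟪v, (B - A) v⟫| ≤ ‖v‖ * ‖(B - A) v‖ := abs_real_inner_le_norm _ _
      _ ≤ ‖v‖ * (δ * ‖v‖) := by
          gcongr
          exact (B - A).le_of_opNorm_le hAB v
      _ = δ * ‖v‖ ^ 2 := by ring
  rw [sub_apply, inner_sub_right] at h
  linarith [neg_le_of_abs_le h]

/-- **Uniform positive definiteness along the gradient-descent iterates** (in the paper
`F` is Fletcher's augmented Lagrangian and this shows the iterates remain in a region of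
uniform positive definiteness).  If `F` is twice continuously differentiable with
`M`-Lipschitz Hessian, `q = βt/6 ∈ (0,1)`, `x_{i+1} = x_i − t∇F(x_i)`,
`vᵀ∇²F(x₀)v ≥ (β/2)‖v‖²` for all `v`, `‖∇F(x_i)‖ ≤ (1−q)^i‖∇F(x₀)‖` for all `i`, and
`M‖∇F(x₀)‖ ≤ β²/36`, then `vᵀ∇²F(x_i)v ≥ (β/3)‖v‖²` for all `i` and `v`. -/
theorem gradient_descent_uniform_positive_definiteness
    {n : ℕ} (F : EuclideanSpace ℝ (Fin n) → ℝ) (hF : ContDiff ℝ 2 F)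
    (M : ℝ)
    (hM : ∀ x y : EuclideanSpace ℝ (Fin n),
      ‖fderiv ℝ (gradient F) x - fderiv ℝ (gradient F) y‖ ≤ M * ‖x - y‖)
    (t β q : ℝ) (ht : 0 < t) (hβ : 0 < β) (hq : q = β * t / 6)
    (hq0 : 0 < q) (hq1 : q < 1)
    (x : ℕ → EuclideanSpace ℝ (Fin n))
    (hx : ∀ i, x (i + 1) = x i - t • gradient F (x i))
    (h1 : ∀ v : EuclideanSpace ℝ (Fin n),
      β / 2 * ‖v‖ ^ 2 ≤ ⟪v, fderiv ℝ (gradient F) (x 0) v⟫)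
    (h2 : ∀ i, ‖gradient F (x i)‖ ≤ (1 - q) ^ i * ‖gradient F (x 0)‖)
    (h3 : M * ‖gradient F (x 0)‖ ≤ β ^ 2 / 36) :
    ∀ i, ∀ v : EuclideanSpace ℝ (Fin n),
      β / 3 * ‖v‖ ^ 2 ≤ ⟪v, fderiv ℝ (gradient F) (x i) v⟫ := by
  intro i v
  have hdist : q * ‖x i - x 0‖ ≤ t * ‖gradient F (x 0)‖ := by
    refine (mul_norm_sub_le_of_geometric_increments (c := t * ‖gradient F (x 0)‖) hq0.le
      (fun j => ?_) i).trans (mul_le_of_le_one_right (by positivity) ?_)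
    · rw [hx, sub_sub_cancel_left, norm_neg, norm_smul, Real.norm_of_nonneg ht.le]
      calc t * ‖gradient F (x j)‖ ≤ t * ((1 - q) ^ j * ‖gradient F (x 0)‖) := by
            gcongr
            exact h2 j
        _ = t * ‖gradient F (x 0)‖ * (1 - q) ^ j := by ring
    · linarith [pow_nonneg (sub_nonneg.2 hq1.le) i]
  have hM_dist : M * ‖x i - x 0‖ ≤ β / 6 := by
    rcases le_total M 0 with hM0 | hM0
    · exact (mul_nonpos_of_nonpos_of_nonneg hM0 (norm_nonneg _)).trans (by positivity)
    · refine le_of_mul_le_mul_left ?_ hq0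
      calc q * (M * ‖x i - x 0‖) = M * (q * ‖x i - x 0‖) := by ring
        _ ≤ M * (t * ‖gradient F (x 0)‖) := by gcongr
        _ = t * (M * ‖gradient F (x 0)‖) := by ring
        _ ≤ t * (β ^ 2 / 36) := by gcongr
        _ = q * (β / 6) := by rw [hq]; ring
  have h := mul_norm_sq_le_inner_of_norm_sub_le (h1 v) ((hM (x i) (x 0)).trans hM_dist)
  rwa [show β / 2 - β / 6 = β / 3 by ring] at h
end

section
/- Let V be a real normed vector space, N ≥ 1 an integer, v_1, …, v_N ∈ V with mean v̄ := (1/N)Σ_{i=1}^N v_i, and suppose γ ≥ 0 satisfies (1/N)Σ_{i=1}^N ‖v_i − v̄‖² ≤ γ. Then for any two nonempty subsets S, S' ⊆ {1,…,N} with S ⊆ S', the sample averages v_S := (1/|S|)Σ_{i∈S} v_i and v_{S'} := (1/|S'|)Σ_{i∈S'} v_i satisfy ‖v_{S'} − v_S‖ ≤ (ξ_S + ξ_{S'})·√γ ≤ 2·ξ_S·√γ, where ξ_T := √(N(N−|T|))/|T|. -/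
/-- Since deviations from the mean sum to zero, Cauchy–Schwarz over the complement of `T` bounds the
distance from the average over `T` to the mean. -/
theorem norm_sample_average_sub_mean_le {ι V : Type*} [Fintype ι] [NormedAddCommGroup V]
    [NormedSpace ℝ V] (v : ι → V) {m : V} (hm : m = (Fintype.card ι : ℝ)⁻¹ • ∑ i, v i)
    {γ : ℝ} (hvar : (Fintype.card ι : ℝ)⁻¹ * ∑ i, ‖v i - m‖ ^ 2 ≤ γ)
    {T : Finset ι} (hT : T.Nonempty) :
    ‖(T.card : ℝ)⁻¹ • (∑ i ∈ T, v i) - m‖ ≤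
      Real.sqrt ((Fintype.card ι : ℝ) * ((Fintype.card ι : ℝ) - T.card)) / T.card *
        Real.sqrt γ := by
  classical
  have hTpos : (0 : ℝ) < T.card := by exact_mod_cast hT.card_pos
  have hle : (T.card : ℝ) ≤ Fintype.card ι := by exact_mod_cast T.card_le_univ
  have hNpos : (0 : ℝ) < Fintype.card ι := hTpos.trans_le hle
  have hzero : ∑ i, (v i - m) = 0 := by
    rw [Finset.sum_sub_distrib, Finset.sum_const, Finset.card_univ, ← Nat.cast_smul_eq_nsmul ℝ,
      hm, smul_inv_smul₀ hNpos.ne', sub_self]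
  have hsum : (T.card : ℝ)⁻¹ • (∑ i ∈ T, v i) - m =
      -((T.card : ℝ)⁻¹ • ∑ i ∈ Tᶜ, (v i - m)) := by
    have hcompl : -∑ i ∈ Tᶜ, (v i - m) = ∑ i ∈ T, (v i - m) := by
      rw [neg_eq_iff_add_eq_zero, add_comm, Finset.sum_add_sum_compl, hzero]
    rw [← smul_neg, hcompl, Finset.sum_sub_distrib, Finset.sum_const, ← Nat.cast_smul_eq_nsmul ℝ,
      smul_sub, inv_smul_smul₀ hTpos.ne']
  have hcard : ((Tᶜ.card : ℕ) : ℝ) = (Fintype.card ι : ℝ) - T.card := by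
    rw [Finset.card_compl, Nat.cast_sub T.card_le_univ]
  have htotal : ∑ i, ‖v i - m‖ ^ 2 ≤ Fintype.card ι * γ := by
    rwa [inv_mul_le_iff₀ hNpos] at hvar
  have hdev : ‖∑ i ∈ Tᶜ, (v i - m)‖ ≤
      Real.sqrt ((Fintype.card ι : ℝ) * ((Fintype.card ι : ℝ) - T.card)) * Real.sqrt γ := by
    rw [← Real.sqrt_mul (mul_nonneg hNpos.le (sub_nonneg.2 hle))]
    apply Real.le_sqrt_of_sq_le
    calc ‖∑ i ∈ Tᶜ, (v i - m)‖ ^ 2 ≤ (∑ i ∈ Tᶜ, ‖v i - m‖) ^ 2 := by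
          gcongr
          exact norm_sum_le _ _
      _ ≤ Tᶜ.card * ∑ i ∈ Tᶜ, ‖v i - m‖ ^ 2 := sq_sum_le_card_mul_sum_sq
      _ ≤ Tᶜ.card * ∑ i, ‖v i - m‖ ^ 2 := by
          gcongr
          exact Finset.subset_univ _
      _ ≤ Tᶜ.card * (Fintype.card ι * γ) := by gcongr
      _ = Fintype.card ι * (Fintype.card ι - T.card) * γ := by
          rw [hcard]
          ring
  rw [hsum, norm_neg, norm_smul, norm_inv, Real.norm_of_nonneg hTpos.le, inv_mul_eq_div,
    div_mul_eq_mul_div]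
  gcongr


/-- **Change of the sample average when the sample set grows** (underlies the warm-start
analysis of the progressive-sampling algorithm).  With mean `v̄ = (1/N)Σvᵢ` and
`(1/N)Σ‖vᵢ − v̄‖² ≤ γ`, for nonempty `S ⊆ S' ⊆ [N]` the sample averages satisfy
`‖v_{S'} − v_S‖ ≤ (ξ_S + ξ_{S'})√γ ≤ 2ξ_S√γ`, where `ξ_T := √(N(N−|T|))/|T|`. -/
theorem sample_average_growth_bound
    {V : Type*} [NormedAddCommGroup V] [NormedSpace ℝ V]
    (N : ℕ) (hN : 1 ≤ N) (v : Fin N → V) (vbar : V)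
    (hvbar : vbar = (N : ℝ)⁻¹ • ∑ i, v i)
    (γ : ℝ) (hγ : 0 ≤ γ)
    (hvar : (N : ℝ)⁻¹ * ∑ i, ‖v i - vbar‖ ^ 2 ≤ γ)
    (S S' : Finset (Fin N)) (hS : S.Nonempty) (hS' : S'.Nonempty) (hSS' : S ⊆ S') :
    ‖(S'.card : ℝ)⁻¹ • (∑ i ∈ S', v i) - (S.card : ℝ)⁻¹ • (∑ i ∈ S, v i)‖ ≤
        (Real.sqrt ((N : ℝ) * ((N : ℝ) - (S.card : ℝ))) / (S.card : ℝ) +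
          Real.sqrt ((N : ℝ) * ((N : ℝ) - (S'.card : ℝ))) / (S'.card : ℝ)) *
          Real.sqrt γ ∧
      (Real.sqrt ((N : ℝ) * ((N : ℝ) - (S.card : ℝ))) / (S.card : ℝ) +
          Real.sqrt ((N : ℝ) * ((N : ℝ) - (S'.card : ℝ))) / (S'.card : ℝ)) *
          Real.sqrt γ ≤
        2 * (Real.sqrt ((N : ℝ) * ((N : ℝ) - (S.card : ℝ))) / (S.card : ℝ)) *
          Real.sqrt γ := by
  have hbound : ∀ T : Finset (Fin N), T.Nonempty →
      ‖(T.card : ℝ)⁻¹ • (∑ i ∈ T, v i) - vbar‖ ≤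
        Real.sqrt ((N : ℝ) * ((N : ℝ) - (T.card : ℝ))) / (T.card : ℝ) * Real.sqrt γ := by
    intro T hT
    simpa only [Fintype.card_fin] using
      norm_sample_average_sub_mean_le v (m := vbar) (by simpa only [Fintype.card_fin] using hvbar)
        (by simpa only [Fintype.card_fin] using hvar) hT
  have hSpos : (0 : ℝ) < S.card := by exact_mod_cast hS.card_pos
  have hcard : (S.card : ℝ) ≤ S'.card := by exact_mod_cast Finset.card_le_card hSS'
  constructor
  · rw [← sub_sub_sub_cancel_right _ _ vbar, add_mul, add_comm]
    exact (norm_sub_le _ _).trans (add_le_add (hbound S' hS') (hbound S hS))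
  · rw [two_mul]
    gcongr
end
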